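/- Fix a finite set 𝒱₀ of prime numbers. There exists a constant C > 0, depending only on 𝒱₀, such that for every real number H ≥ 20, the number of positive integers n ≤ H that do not lie in any good unfiltered grid of height ≤ H is at most C · H · ( exp(exp((1/3)·log log log H)) )^{−1/3}. -/

import Mathlib

/-- `α₀(H) = exp(exp(exp((1/3)·log log log H)))`. -/
noncomputable def alpha0 (H : ℝ) : ℝ :=
  Real.exp (Real.exp (Real.exp ((1/3) * Real.log (Real.log (Real.log H)))))

/-- `α(H) = exp(1 / exp(exp(exp((1/4)·log log log H))))`. -/
noncomputable def alphaH (H : ℝ) : ℝ :=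
  Real.exp (1 / Real.exp (Real.exp (Real.exp ((1/4) * Real.log (Real.log (Real.log H))))))

/-- `𝒫_i(H)`: the set of primes `p ∉ 𝒱₀` with `α₀(H)·α(H)^i ≤ p < α₀(H)·α(H)^(i+1)`. -/
def primeInterval (V₀ : Finset ℕ) (H : ℝ) (i : ℕ) : Set ℕ :=
  {p : ℕ | p.Prime ∧ p ∉ V₀ ∧ alpha0 H * alphaH H ^ i ≤ (p : ℝ) ∧
    (p : ℝ) < alpha0 H * alphaH H ^ (i + 1)}

/-- `n` lies in a good unfiltered grid of height `≤ H` (with respect to the finite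
set of primes `𝒱₀`). -/
def InGoodGrid (V₀ : Finset ℕ) (H : ℝ) (n : ℕ) : Prop :=
  ∃ (b r : ℕ) (k : Fin r → ℕ) (p : Fin r → ℕ),
    0 < b ∧ 1 ≤ r ∧
    (∀ q ∈ b.primeFactors, (q : ℝ) < alpha0 H) ∧
    StrictMono k ∧
    (∀ i, p i ∈ primeInterval V₀ H (k i)) ∧
    n = b * ∏ i, p i ∧
    -- (1) reasonable amount of primes
    (Real.log (Real.log H) - Real.log (Real.log H) ^ ((3 : ℝ)/4) ≤ (r : ℝ) ∧
      (r : ℝ) ≤ Real.log (Real.log H) + Real.log (Real.log H) ^ ((3 : ℝ)/4)) ∧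
    -- (2) height of the grid
    (∀ q : Fin r → ℕ, (∀ i, q i ∈ primeInterval V₀ H (k i)) →
      (b : ℝ) * ∏ i, (q i : ℝ) ≤ H) ∧
    -- (3) few small primes
    ((b.primeFactors.card : ℝ) ≤ Real.log (Real.log H) ^ ((1 : ℝ)/3 + 1/100) ∧
      ∀ i : Fin r, Real.log (Real.log H) ^ ((1 : ℝ)/2 + 1/100) < ((i : ℕ) : ℝ) + 1 →
        ∀ q ∈ primeInterval V₀ H (k i),
          Real.exp (Real.exp (Real.exp ((1/2) * Real.log (Real.log (Real.log H))))) ≤ (q : ℝ))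


open Finset ArithmeticFunction in
/-- One half of Mertens' first theorem. -/
theorem exists_sum_primesLE_log_div_le :
    ∃ K : ℝ, 0 ≤ K ∧ ∀ N : ℕ, 1 ≤ N →
      ∑ p ∈ Nat.primesLE N, Real.log p / p ≤ Real.log N + K := by
  refine ⟨Real.log 4 + 4, by positivity, fun N hN => ?_⟩
  have hN' : (0 : ℝ) < N := by exact_mod_cast hN
  have hpsi : ∑ d ∈ Ioc 0 N, Λ d ≤ (Real.log 4 + 4) * N := by
    have := Chebyshev.psi_le_const_mul_self (x := N) (by positivity)
    rwa [Chebyshev.psi, Nat.floor_natCast] at this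
  have hfac : ∑ d ∈ Ioc 0 N, Λ d * ((N / d : ℕ) : ℝ) ≤ N * Real.log N := by
    rw [← sum_Ioc_mul_zeta_eq_sum, vonMangoldt_mul_zeta]
    calc ∑ n ∈ Ioc 0 N, ArithmeticFunction.log n ≤ ∑ n ∈ Ioc 0 N, Real.log N := by
          refine sum_le_sum fun n hn => ?_
          rw [mem_Ioc] at hn
          rw [ArithmeticFunction.log_apply]
          exact Real.log_le_log (by exact_mod_cast hn.1) (by exact_mod_cast hn.2)
      _ = N * Real.log N := by simp
  have hdiv : ∑ d ∈ Ioc 0 N, Λ d * ((N : ℝ) / d) ≤ N * Real.log N + (Real.log 4 + 4) * N := by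
    calc ∑ d ∈ Ioc 0 N, Λ d * ((N : ℝ) / d)
        ≤ ∑ d ∈ Ioc 0 N, (Λ d * ((N / d : ℕ) : ℝ) + Λ d) := by
          refine sum_le_sum fun d _ => ?_
          have h := (Nat.lt_floor_add_one ((N : ℝ) / d)).le
          rw [Nat.floor_div_natCast, Nat.floor_natCast] at h
          have := mul_le_mul_of_nonneg_left h (vonMangoldt_nonneg (n := d))
          linarith
      _ ≤ _ := by rw [sum_add_distrib]; exact add_le_add hfac hpsi
  have hprime : ∑ p ∈ Nat.primesLE N, Real.log p / p ≤ ∑ d ∈ Ioc 0 N, Λ d / d := by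
    rw [Nat.primesLE_eq_filter_Ioc_zero]
    calc _ = ∑ p ∈ Ioc 0 N with p.Prime, Λ p / p := by
          refine sum_congr rfl fun p hp => ?_
          rw [vonMangoldt_apply_prime (mem_filter.1 hp).2]
      _ ≤ _ := sum_le_sum_of_subset_of_nonneg (filter_subset _ _) fun d _ _ =>
          div_nonneg vonMangoldt_nonneg (by positivity)
  have heq : ∑ d ∈ Ioc 0 N, Λ d * ((N : ℝ) / d) = N * ∑ d ∈ Ioc 0 N, Λ d / d := by
    rw [mul_sum]; exact sum_congr rfl fun d _ => by ring
  rw [heq] at hdiv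
  refine hprime.trans (le_of_mul_le_mul_left (hdiv.trans_eq ?_) hN')
  ring

/-- The upper bound in Mertens' second theorem. -/
theorem exists_sum_primesLE_inv_le :
    ∃ M : ℝ, 0 ≤ M ∧ ∀ N : ℕ, 2 ≤ N →
      ∑ p ∈ Nat.primesLE N, 1 / (p : ℝ) ≤ Real.log (Real.log N) + M := by
  obtain ⟨K, hK0, hK⟩ := exists_sum_primesLE_log_div_le
  obtain ⟨M', hM'⟩ : ∃ M' : ℝ, M' = |(∑ p ∈ Nat.primesLE 2, 1 / (p : ℝ)) -
    (∑ p ∈ Nat.primesLE 2, Real.log p / p) / Real.log 2 - Real.log (Real.log 2) +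
      K / Real.log 2| := ⟨_, rfl⟩
  have key : ∀ N : ℕ, 2 ≤ N → (∑ p ∈ Nat.primesLE N, 1 / (p : ℝ)) -
      (∑ p ∈ Nat.primesLE N, Real.log p / p) / Real.log N ≤
        Real.log (Real.log N) - K / Real.log N + M' := by
    intro N hN
    induction N, hN using Nat.le_induction with
    | base =>
      rw [hM']
      have := le_abs_self ((∑ p ∈ Nat.primesLE 2, 1 / (p : ℝ)) -
        (∑ p ∈ Nat.primesLE 2, Real.log p / p) / Real.log 2 - Real.log (Real.log 2) +
          K / Real.log 2)
      push_cast
      linarith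
    | succ n hn ih =>
      have hlog : 0 < Real.log n := Real.log_pos (by exact_mod_cast hn)
      have hlt : Real.log n < Real.log (n + 1 : ℕ) :=
        Real.log_lt_log (by exact_mod_cast (by omega : 0 < n)) (by push_cast; linarith)
      have hlog' := hlog.trans hlt
      have hstep : (∑ p ∈ Nat.primesLE (n + 1), 1 / (p : ℝ)) -
          (∑ p ∈ Nat.primesLE (n + 1), Real.log p / p) / Real.log (n + 1 : ℕ) =
          (∑ p ∈ Nat.primesLE n, 1 / (p : ℝ)) -
          (∑ p ∈ Nat.primesLE n, Real.log p / p) / Real.log (n + 1 : ℕ) := by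
        rw [Nat.primesLE_eq_filter_range, Nat.primesLE_eq_filter_range, Finset.range_add_one (n := n + 1),
          Finset.filter_insert]
        split_ifs with hp
        · rw [Finset.sum_insert (by simp), Finset.sum_insert (by simp)]
          have : ((n + 1 : ℕ) : ℝ) ≠ 0 := by positivity
          field_simp
          ring
        · rfl
      rw [hstep]
      have h1 : (∑ p ∈ Nat.primesLE n, Real.log p / p) *
          (1 / Real.log n - 1 / Real.log (n + 1 : ℕ)) ≤
          (Real.log n + K) * (1 / Real.log n - 1 / Real.log (n + 1 : ℕ)) :=
        mul_le_mul_of_nonneg_right (hK n (by omega))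
          (sub_nonneg.2 (one_div_le_one_div_of_le hlog hlt.le))
      have h2 : 1 - Real.log n / Real.log (n + 1 : ℕ) ≤
          Real.log (Real.log (n + 1 : ℕ)) - Real.log (Real.log n) := by
        have := Real.one_sub_inv_le_log_of_pos (div_pos hlog' hlog)
        rwa [Real.log_div hlog'.ne' hlog.ne', inv_div] at this
      have h3 : (Real.log n + K) * (1 / Real.log n - 1 / Real.log (n + 1 : ℕ)) =
          1 - Real.log n / Real.log (n + 1 : ℕ) + K / Real.log n - K / Real.log (n + 1 : ℕ) := by
        field_simp
        ring
      have h4 : (∑ p ∈ Nat.primesLE n, Real.log p / p) *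
          (1 / Real.log n - 1 / Real.log (n + 1 : ℕ)) =
          (∑ p ∈ Nat.primesLE n, Real.log p / p) / Real.log n -
          (∑ p ∈ Nat.primesLE n, Real.log p / p) / Real.log (n + 1 : ℕ) := by ring
      linarith
  have hM'0 : 0 ≤ M' := hM' ▸ abs_nonneg _
  refine ⟨M' + 1, by linarith, fun N hN => ?_⟩
  have hlog : 0 < Real.log N := Real.log_pos (by exact_mod_cast hN)
  have h1 := key N hN
  have h2 : (∑ p ∈ Nat.primesLE N, Real.log p / p) / Real.log N ≤ (Real.log N + K) / Real.log N :=
    div_le_div_of_nonneg_right (hK N (by omega)) hlog.le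
  rw [add_div, div_self hlog.ne'] at h2
  linarith

/-- The number of prime factors of `n` lying in `E`. -/
noncomputable def cardPrimeFactorsIn (E : Set ℕ) (n : ℕ) : ℕ :=
  open Classical in {p ∈ n.primeFactors | p ∈ E}.card

/-- The sum of the reciprocals of the primes up to `N` lying in `E`. -/
noncomputable def sumPrimeInv (E : Set ℕ) (N : ℕ) : ℝ :=
  open Classical in ∑ p ∈ Nat.primesLE N with p ∈ E, 1 / (p : ℝ)

theorem cardPrimeFactorsIn_mul_of_coprime (E : Set ℕ) {m n : ℕ} (h : m.Coprime n) :
    cardPrimeFactorsIn E (m * n) = cardPrimeFactorsIn E m + cardPrimeFactorsIn E n := by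
  classical
  unfold cardPrimeFactorsIn
  rw [h.primeFactors_mul, Finset.filter_union, Finset.card_union_of_disjoint]
  exact Finset.disjoint_filter_filter h.disjoint_primeFactors

theorem cardPrimeFactorsIn_prime_pow (E : Set ℕ) [DecidablePred (· ∈ E)] {p k : ℕ} (hp : p.Prime)
    (hk : k ≠ 0) :
    cardPrimeFactorsIn E (p ^ k) = if p ∈ E then 1 else 0 := by
  unfold cardPrimeFactorsIn
  rw [Nat.primeFactors_pow _ hk, hp.primeFactors, Finset.filter_singleton]
  split_ifs <;> rfl

theorem cardPrimeFactorsIn_le_mul (E : Set ℕ) {m n : ℕ} (hm : m ≠ 0) (hn : n ≠ 0) :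
    cardPrimeFactorsIn E n ≤ cardPrimeFactorsIn E (m * n) := by
  classical
  unfold cardPrimeFactorsIn
  refine Finset.card_le_card (Finset.filter_subset_filter _ ?_)
  exact Nat.primeFactors_mono (Dvd.intro_left m rfl) (mul_ne_zero hm hn)

theorem cardPrimeFactorsIn_mul_le (E : Set ℕ) (m n : ℕ) :
    cardPrimeFactorsIn E (m * n) ≤ cardPrimeFactorsIn E m + cardPrimeFactorsIn E n := by
  classical
  rcases eq_or_ne m 0 with rfl | hm
  · simp [cardPrimeFactorsIn]
  rcases eq_or_ne n 0 with rfl | hn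
  · simp [cardPrimeFactorsIn]
  unfold cardPrimeFactorsIn
  rw [Nat.primeFactors_mul hm hn, Finset.filter_union]
  exact Finset.card_union_le _ _

theorem sum_one_div_mul_pred_le (s : Finset ℕ) (hs : ∀ p ∈ s, 2 ≤ p) :
    ∑ p ∈ s, 1 / ((p : ℝ) * (p - 1)) ≤ 1 := by
  have hsub : s ⊆ Finset.Ico 2 (s.sup id + 2) := fun p hp => by
    rw [Finset.mem_Ico]
    exact ⟨hs p hp, by have := Finset.le_sup (f := id) hp; simp only [id] at this; omega⟩
  have htel : ∀ n : ℕ, ∑ p ∈ Finset.Ico 2 (n + 2), 1 / ((p : ℝ) * (p - 1)) = 1 - 1 / (n + 1 : ℝ) := by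
    intro n
    induction n with
    | zero => simp
    | succ n ih =>
      rw [Finset.sum_Ico_succ_top (by omega), ih]
      push_cast
      have h1 : (n : ℝ) + 1 ≠ 0 := by positivity
      have h2 : (n : ℝ) + 2 ≠ 0 := by positivity
      rw [show (n : ℝ) + 2 - 1 = n + 1 by ring, show (n : ℝ) + 1 + 1 = n + 2 by ring]
      field_simp
      ring
  calc _ ≤ ∑ p ∈ Finset.Ico 2 (s.sup id + 2), 1 / ((p : ℝ) * (p - 1)) := by
        refine Finset.sum_le_sum_of_subset_of_nonneg hsub fun p hp _ => ?_
        have : (2 : ℝ) ≤ p := by exact_mod_cast (Finset.mem_Ico.1 hp).1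
        have : (0 : ℝ) ≤ p - 1 := by linarith
        positivity
    _ ≤ 1 := by
        rw [htel]
        have : (0 : ℝ) ≤ 1 / ((s.sup id : ℕ) + 1 : ℝ) := by positivity
        linarith

theorem sum_exp_cardPrimeFactorsIn_div_le (E : Set ℕ) {t : ℝ} (ht : t ≤ 1) (N : ℕ) :
    ∑ n ∈ Finset.Ioc 0 N, Real.exp (t * cardPrimeFactorsIn E n) / n ≤
      Real.exp (∑ p ∈ Nat.primesLE N, 1 / (p : ℝ) + (Real.exp t - 1) * sumPrimeInv E N + 3) := by
  classical
  set f : ℕ → ℝ := fun n => Real.exp (t * cardPrimeFactorsIn E n) / n with hf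
  set g : ℕ → ℝ := fun p => if p ∈ E then Real.exp t else 1 with hg
  have hg0 : ∀ p, 0 ≤ g p := fun p => by simp only [hg]; split_ifs <;> positivity
  have hg3 : ∀ p, g p ≤ 3 := fun p => by
    simp only [hg]
    split_ifs
    · exact (Real.exp_le_exp.2 ht).trans Real.exp_one_lt_three.le
    · norm_num
  have hf0 : ∀ n, 0 ≤ f n := fun n => by positivity
  have hf1 : f 1 = 1 := by simp [hf, cardPrimeFactorsIn]
  have hmul : ∀ {m n : ℕ}, m.Coprime n → f (m * n) = f m * f n := fun {m n} h => by
    simp only [hf, cardPrimeFactorsIn_mul_of_coprime E h]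
    push_cast
    rw [mul_add, Real.exp_add, mul_div_mul_comm]
  have hpow : ∀ {p : ℕ}, p.Prime → ∀ k : ℕ, f (p ^ (k + 1)) = g p / p * (1 / (p : ℝ)) ^ k := by
    intro p hp k
    simp only [hf, hg, cardPrimeFactorsIn_prime_pow E hp k.succ_ne_zero]
    split_ifs
    · simp [pow_succ]
      ring
    · simp [pow_succ]
  have hgeo : ∀ {p : ℕ}, p.Prime → HasSum (fun k => f (p ^ (k + 1)))
      (g p / p * (1 - 1 / (p : ℝ))⁻¹) := by
    intro p hp
    simp only [hpow hp]
    refine (hasSum_geometric_of_lt_one (by positivity) ?_).mul_left _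
    rw [div_lt_one (by exact_mod_cast hp.pos)]
    exact_mod_cast hp.one_lt
  have hsum : ∀ {p : ℕ}, p.Prime → Summable fun k => ‖f (p ^ k)‖ := by
    intro p hp
    simp only [Real.norm_of_nonneg (hf0 _)]
    exact (summable_nat_add_iff 1).1 (hgeo hp).summable
  have htsum : ∀ {p : ℕ}, p.Prime → ∑' k, f (p ^ k) ≤
      Real.exp (g p / p + 3 * (1 / ((p : ℝ) * (p - 1)))) := by
    intro p hp
    have hs : Summable fun k => f (p ^ k) := (hsum hp).of_norm
    rw [hs.tsum_eq_zero_add, (hgeo hp).tsum_eq, pow_zero, hf1, add_comm]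
    refine le_trans ?_ (Real.add_one_le_exp _)
    have h2 : (2 : ℝ) ≤ p := by exact_mod_cast hp.two_le
    have h0 : (p : ℝ) ≠ 0 := by positivity
    have h1 : (p : ℝ) - 1 ≠ 0 := by intro h; linarith
    have : g p / p * (1 - 1 / (p : ℝ))⁻¹ = g p / p + g p * (1 / ((p : ℝ) * (p - 1))) := by
      have : 1 - 1 / (p : ℝ) = (p - 1) / p := by field_simp
      rw [this]
      field_simp
      ring
    rw [this]
    gcongr
    · have : (0 : ℝ) ≤ p - 1 := by linarith
      positivity
    · exact hg3 p
  obtain ⟨hsmooth, hprod⟩ := EulerProduct.summable_and_hasSum_smoothNumbers_prod_primesBelow_tsum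
    hf1 hmul hsum (N + 1)
  calc ∑ n ∈ Finset.Ioc 0 N, f n
      ≤ ∏ p ∈ (N + 1).primesBelow, ∑' k, f (p ^ k) := by
        have hmem : ∀ n ∈ Finset.Ioc 0 N, n ∈ (N + 1).smoothNumbers := fun n hn => by
          rw [Finset.mem_Ioc] at hn
          exact Nat.mem_smoothNumbers_of_lt hn.1 (by omega)
        have := sum_le_hasSum ((Finset.Ioc 0 N).subtype (· ∈ (N + 1).smoothNumbers))
          (fun i _ => hf0 i) hprod
        rwa [Finset.sum_subtype_of_mem f hmem] at this
    _ ≤ ∏ p ∈ (N + 1).primesBelow, Real.exp (g p / p + 3 * (1 / ((p : ℝ) * (p - 1)))) :=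
        Finset.prod_le_prod (fun p _ => tsum_nonneg fun k => hf0 _)
          fun p hp => htsum (Nat.prime_of_mem_primesBelow hp)
    _ ≤ _ := by
        rw [← Real.exp_sum, Real.exp_le_exp, Finset.sum_add_distrib, ← Finset.mul_sum]
        have h1 := sum_one_div_mul_pred_le (N + 1).primesBelow
          fun p hp => Nat.two_le_of_mem_primesBelow hp
        have h2 : ∑ p ∈ (N + 1).primesBelow, g p / p =
            ∑ p ∈ Nat.primesLE N, 1 / (p : ℝ) + (Real.exp t - 1) * sumPrimeInv E N := by
          rw [sumPrimeInv, Finset.sum_filter, Finset.mul_sum, ← Finset.sum_add_distrib]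
          refine Finset.sum_congr rfl fun p _ => ?_
          simp only [hg]
          split_ifs <;> ring
        linarith

/-- The lower bound in Mertens' second theorem. -/
theorem log_log_le_sum_primesLE_inv {x : ℝ} (hx : 1 < x) :
    Real.log (Real.log x) ≤ ∑ p ∈ Nat.primesLE ⌊x⌋₊, 1 / (p : ℝ) + 3 := by
  have h := sum_exp_cardPrimeFactorsIn_div_le ∅ zero_le_one ⌊x⌋₊
  have h2 := Real.log_le_log (Real.log_pos hx)
    ((log_le_harmonic_floor x (by linarith)).trans (le_trans ?_ h))
  · rw [Real.log_exp] at h2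
    simpa using h2
  · rw [harmonic_eq_sum_Icc]
    push_cast
    simp [← Finset.Icc_add_one_left_eq_Ioc]

open Finset ArithmeticFunction in
/-- The Hall-Tenenbaum inequality for the multiplicative functions `n ↦ exp (t * ω(n; E))`. -/
theorem exists_sum_exp_cardPrimeFactorsIn_le :
    ∃ K : ℝ, 0 < K ∧ ∀ (E : Set ℕ) (t : ℝ), t ≤ 1 → ∀ N : ℕ, 2 ≤ N →
      ∑ n ∈ Ioc 0 N, Real.exp (t * cardPrimeFactorsIn E n) ≤
        K * N * Real.exp ((Real.exp t - 1) * sumPrimeInv E N) := by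
  classical
  obtain ⟨M, hM0, hM⟩ := exists_sum_primesLE_inv_le
  obtain ⟨c, hc⟩ : ∃ c : ℝ, c = Real.log 4 + 4 := ⟨_, rfl⟩
  have hc0 : 0 < c := by rw [hc]; positivity
  refine ⟨(3 * c + 1) * Real.exp (M + 3), by positivity, fun E t ht N hN => ?_⟩
  have hNpos : (0 : ℝ) < N := by exact_mod_cast (by omega : 0 < N)
  have hlogN : 0 < Real.log N := Real.log_pos (by exact_mod_cast hN)
  set h : ℕ → ℝ := fun n => Real.exp (t * cardPrimeFactorsIn E n) with hh
  have hh0 : ∀ n, 0 < h n := fun n => Real.exp_pos _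
  let f : ArithmeticFunction ℝ := ⟨fun n => if n = 0 then 0 else h n, by simp⟩
  have hf : ∀ n, n ≠ 0 → f n = h n := fun n hn => by
    change (if n = 0 then 0 else h n) = h n
    rw [if_neg hn]
  have hle : ∀ d m : ℕ, d ≠ 0 → m ≠ 0 → IsPrimePow d → h (d * m) ≤ 3 * h m := by
    intro d m hd hm hpp
    rw [show (3 : ℝ) * h m = 3 * Real.exp (t * cardPrimeFactorsIn E m) from rfl]
    change Real.exp _ ≤ _
    have hd1 : cardPrimeFactorsIn E d ≤ 1 := by
      rw [isPrimePow_nat_iff] at hpp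
      obtain ⟨p, k, hp, hk, rfl⟩ := hpp
      rw [cardPrimeFactorsIn_prime_pow E hp hk.ne']
      split_ifs <;> simp
    have h1 : (cardPrimeFactorsIn E m : ℝ) ≤ cardPrimeFactorsIn E (d * m) := by
      exact_mod_cast cardPrimeFactorsIn_le_mul E hd hm
    have h2 : (cardPrimeFactorsIn E (d * m) : ℝ) ≤ 1 + cardPrimeFactorsIn E m := by
      exact_mod_cast (cardPrimeFactorsIn_mul_le E d m).trans (by omega)
    calc Real.exp (t * cardPrimeFactorsIn E (d * m))
        ≤ Real.exp (1 + t * cardPrimeFactorsIn E m) := by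
          rw [Real.exp_le_exp]
          rcases le_total 0 t with h0 | h0
          · nlinarith
          · nlinarith
      _ ≤ 3 * Real.exp (t * cardPrimeFactorsIn E m) := by
          rw [Real.exp_add]
          gcongr
          exact Real.exp_one_lt_three.le
  have hlog : ∑ n ∈ Ioc 0 N, h n * Real.log n ≤ 3 * (c * (N * ∑ n ∈ Ioc 0 N, h n / n)) := by
    calc ∑ n ∈ Ioc 0 N, h n * Real.log n
        ≤ ∑ n ∈ Ioc 0 N, 3 * (f * Λ) n := by
          refine sum_le_sum fun n hn => ?_
          rw [mul_comm f, ArithmeticFunction.mul_apply, ← vonMangoldt_sum, mul_sum, mul_sum,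
            ← Nat.map_div_right_divisors, sum_map]
          refine sum_le_sum fun d hd => ?_
          obtain ⟨m, hm⟩ := Nat.dvd_of_mem_divisors hd
          have hn0 : n ≠ 0 := (Nat.mem_divisors.1 hd).2
          have hd0 : d ≠ 0 := by rintro rfl; simp at hm; exact hn0 hm
          have hm0 : m ≠ 0 := by rintro rfl; simp at hm; exact hn0 hm
          change h n * Λ d ≤ 3 * (Λ d * f (n / d))
          rw [hm, Nat.mul_div_cancel_left _ (Nat.pos_of_ne_zero hd0), hf m hm0]
          by_cases hpp : IsPrimePow d
          · have := mul_le_mul_of_nonneg_right (hle d m hd0 hm0 hpp) (vonMangoldt_nonneg (n := d))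
            linarith
          · rw [vonMangoldt_eq_zero_iff.2 hpp]; simp
      _ = 3 * ∑ m ∈ Ioc 0 N, f m * ∑ d ∈ Ioc 0 (N / m), Λ d := by
          rw [← mul_sum, sum_Ioc_mul_eq_sum_sum]
      _ ≤ 3 * ∑ m ∈ Ioc 0 N, h m * (c * (N / m)) := by
          refine mul_le_mul_of_nonneg_left (sum_le_sum fun m hm => ?_) (by norm_num)
          rw [hf m (by rw [mem_Ioc] at hm; omega)]
          refine mul_le_mul_of_nonneg_left ?_ (hh0 m).le
          have := Chebyshev.psi_le_const_mul_self (x := (N / m : ℝ)) (by positivity)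
          rwa [Chebyshev.psi, Nat.floor_div_natCast, Nat.floor_natCast, ← hc] at this
      _ = 3 * (c * (N * ∑ n ∈ Ioc 0 N, h n / n)) := by
          rw [mul_sum, mul_sum, mul_sum, mul_sum]
          exact sum_congr rfl fun m _ => by ring
  have hlog' : ∑ n ∈ Ioc 0 N, h n * (Real.log N - Real.log n) ≤ N * ∑ n ∈ Ioc 0 N, h n / n := by
    rw [mul_sum]
    refine sum_le_sum fun n hn => ?_
    rw [mem_Ioc] at hn
    have hn0 : (0 : ℝ) < n := by exact_mod_cast hn.1
    rw [← Real.log_div hNpos.ne' hn0.ne']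
    have := Real.log_le_self (x := (N / n : ℝ)) (by positivity)
    calc h n * Real.log (N / n) ≤ h n * (N / n) := mul_le_mul_of_nonneg_left this (hh0 n).le
      _ = _ := by ring
  have htot : Real.log N * ∑ n ∈ Ioc 0 N, h n ≤ (3 * c + 1) * (N * ∑ n ∈ Ioc 0 N, h n / n) := by
    have : Real.log N * ∑ n ∈ Ioc 0 N, h n = ∑ n ∈ Ioc 0 N, h n * Real.log n +
        ∑ n ∈ Ioc 0 N, h n * (Real.log N - Real.log n) := by
      rw [← sum_add_distrib, mul_sum]
      exact sum_congr rfl fun n _ => by ring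
    rw [this]
    linarith
  have hbound : ∑ n ∈ Ioc 0 N, h n / n ≤
      Real.log N * (Real.exp (M + 3) * Real.exp ((Real.exp t - 1) * sumPrimeInv E N)) := by
    refine (sum_exp_cardPrimeFactorsIn_div_le E ht N).trans ?_
    nth_rewrite 1 [← Real.exp_log hlogN]
    rw [← Real.exp_add, ← Real.exp_add, Real.exp_le_exp]
    have := hM N hN
    linarith
  refine le_of_mul_le_mul_left (htot.trans ?_) hlogN
  calc (3 * c + 1) * (N * ∑ n ∈ Ioc 0 N, h n / n)
      ≤ (3 * c + 1) * (N * (Real.log N *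
        (Real.exp (M + 3) * Real.exp ((Real.exp t - 1) * sumPrimeInv E N)))) := by gcongr
    _ = _ := by ring

/-- Chernoff bound for the number of prime factors in `E` of the integers up to `N`. -/
theorem exists_card_le_mul_cardPrimeFactorsIn :
    ∃ K : ℝ, 0 < K ∧ ∀ (E : Set ℕ) (t Y : ℝ), t ≤ 1 → ∀ N : ℕ, 2 ≤ N →
      ({n ∈ Finset.Ioc 0 N | Y ≤ t * cardPrimeFactorsIn E n}.card : ℝ) ≤
        K * N * Real.exp ((Real.exp t - 1) * sumPrimeInv E N - Y) := by
  obtain ⟨K, hK0, hK⟩ := exists_sum_exp_cardPrimeFactorsIn_le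
  refine ⟨K, hK0, fun E t Y ht N hN => ?_⟩
  rw [Real.exp_sub, ← mul_div_assoc, le_div_iff₀ (Real.exp_pos _)]
  refine le_trans ?_ (hK E t ht N hN)
  calc ({n ∈ Finset.Ioc 0 N | Y ≤ t * cardPrimeFactorsIn E n}.card : ℝ) * Real.exp Y
      = ∑ n ∈ Finset.Ioc 0 N with Y ≤ t * cardPrimeFactorsIn E n, Real.exp Y := by simp
    _ ≤ ∑ n ∈ Finset.Ioc 0 N with Y ≤ t * cardPrimeFactorsIn E n,
          Real.exp (t * cardPrimeFactorsIn E n) :=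
        Finset.sum_le_sum fun n hn => Real.exp_le_exp.2 (Finset.mem_filter.1 hn).2
    _ ≤ _ := Finset.sum_le_sum_of_subset_of_nonneg (Finset.filter_subset _ _)
        fun n _ _ => (Real.exp_pos _).le

/-- Few integers up to `N` are divisible by a product `p * q` with `a ≤ p ≤ q < β * p`. -/
theorem card_exists_mul_dvd_le {a β : ℝ} (ha : 0 < a) (hβ : 1 ≤ β) {N : ℕ} (hN : 1 ≤ N) :
    ((open Classical in {n ∈ Finset.Ioc 0 N | ∃ p q : ℕ, a ≤ p ∧ p ≤ q ∧ (q : ℝ) < β * p ∧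
        p * q ∣ n}).card : ℝ) ≤ N * ((β - 1 + 1 / a) * (1 + Real.log N)) := by
  classical
  let Q : ℕ → Finset ℕ := fun p => {q ∈ Finset.Icc p N | (q : ℝ) < β * p}
  let P : Finset ℕ := {p ∈ Finset.Icc 1 N | a ≤ (p : ℝ)}
  have hsub : {n ∈ Finset.Ioc 0 N | ∃ p q : ℕ, a ≤ p ∧ p ≤ q ∧ (q : ℝ) < β * p ∧ p * q ∣ n} ⊆
      P.biUnion fun p => (Q p).biUnion fun q => {n ∈ Finset.Ioc 0 N | p * q ∣ n} := by
    intro n hn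
    simp only [Finset.mem_filter, Finset.mem_Ioc] at hn
    obtain ⟨⟨hn0, hnN⟩, p, q, hap, hpq, hq, hd⟩ := hn
    have hp0 : 0 < p := by exact_mod_cast ha.trans_le hap
    have hqn : q ≤ n := Nat.le_of_dvd hn0 ((Dvd.intro_left p rfl).trans hd)
    simp only [Finset.mem_biUnion, P, Q, Finset.mem_filter, Finset.mem_Icc, Finset.mem_Ioc]
    exact ⟨p, ⟨⟨hp0, by omega⟩, hap⟩, q, ⟨⟨hpq, by omega⟩, hq⟩, ⟨hn0, hnN⟩, hd⟩
  have hcardQ : ∀ p ∈ P, ((Q p).card : ℝ) ≤ (β - 1 + 1 / a) * p := by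
    intro p hp
    simp only [P, Finset.mem_filter, Finset.mem_Icc] at hp
    have hp0 : (0 : ℝ) < p := ha.trans_le hp.2
    have h0 : 0 ≤ (β - 1) * p := mul_nonneg (by linarith) hp0.le
    have hQ : Q p ⊆ Finset.Icc p (p + ⌊(β - 1) * p⌋₊) := by
      intro q hq
      simp only [Q, Finset.mem_filter, Finset.mem_Icc] at hq ⊢
      refine ⟨hq.1.1, ?_⟩
      have : q - p ≤ ⌊(β - 1) * p⌋₊ := by
        refine Nat.le_floor ?_
        rw [Nat.cast_sub hq.1.1]
        linarith [hq.2]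
      omega
    have h1 := Finset.card_le_card hQ
    rw [Nat.card_Icc] at h1
    have h2 : ((Q p).card : ℝ) ≤ ⌊(β - 1) * p⌋₊ + 1 := by
      exact_mod_cast h1.trans (by omega)
    have h3 := Nat.floor_le h0
    have h4 : 1 ≤ 1 / a * p := by
      rw [one_div, ← div_eq_inv_mul, le_div_iff₀ ha]
      linarith [hp.2]
    linarith
  have hpos : 0 ≤ β - 1 + 1 / a := by
    have := one_div_pos.2 ha
    linarith
  calc ({n ∈ Finset.Ioc 0 N | ∃ p q : ℕ, a ≤ p ∧ p ≤ q ∧ (q : ℝ) < β * p ∧ p * q ∣ n}.card : ℝ)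
      ≤ ∑ p ∈ P, ∑ q ∈ Q p, ({n ∈ Finset.Ioc 0 N | p * q ∣ n}.card : ℝ) := by
        exact_mod_cast (Finset.card_le_card hsub).trans (Finset.card_biUnion_le.trans
          (Finset.sum_le_sum fun p _ => Finset.card_biUnion_le))
    _ ≤ ∑ p ∈ P, ∑ q ∈ Q p, (N : ℝ) / (p * p) := by
        refine Finset.sum_le_sum fun p hp => Finset.sum_le_sum fun q hq => ?_
        rw [Nat.Ioc_filter_dvd_card_eq_div]
        simp only [P, Q, Finset.mem_filter, Finset.mem_Icc] at hp hq
        refine Nat.cast_div_le.trans ?_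
        have : (0 : ℝ) < p := ha.trans_le hp.2
        have : (p : ℝ) ≤ q := by exact_mod_cast hq.1.1
        push_cast
        gcongr
    _ ≤ ∑ p ∈ P, N * (β - 1 + 1 / a) * (1 / (p : ℝ)) := by
        refine Finset.sum_le_sum fun p hp => ?_
        rw [Finset.sum_const, nsmul_eq_mul]
        have h1 := hcardQ p hp
        simp only [P, Finset.mem_filter, Finset.mem_Icc] at hp
        have hp0 : (0 : ℝ) < p := ha.trans_le hp.2
        calc ((Q p).card : ℝ) * (N / (p * p)) ≤ (β - 1 + 1 / a) * p * (N / (p * p)) := by gcongr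
          _ = _ := by field_simp
    _ ≤ N * (β - 1 + 1 / a) * ∑ p ∈ Finset.Icc 1 N, 1 / (p : ℝ) := by
        rw [← Finset.mul_sum]
        refine mul_le_mul_of_nonneg_left (Finset.sum_le_sum_of_subset_of_nonneg
          (Finset.filter_subset _ _) fun _ _ _ => by positivity) (by positivity)
    _ ≤ N * (β - 1 + 1 / a) * (1 + Real.log N) := by
        refine mul_le_mul_of_nonneg_left ?_ (by positivity)
        have := harmonic_le_one_add_log N
        rw [harmonic_eq_sum_Icc] at this
        push_cast at this
        simpa using this
    _ = _ := by ring

theorem cardPrimeFactorsIn_eq_card_filter (E : Set ℕ) [DecidablePred (· ∈ E)] (n : ℕ) :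
    cardPrimeFactorsIn E n = {p ∈ n.primeFactors | p ∈ E}.card := by
  unfold cardPrimeFactorsIn
  congr

theorem alpha0_pos (H : ℝ) : 0 < alpha0 H := Real.exp_pos _

theorem one_lt_alphaH (H : ℝ) : 1 < alphaH H := Real.one_lt_exp_iff.2 (by positivity)

theorem exists_mem_primeInterval {V₀ : Finset ℕ} {H : ℝ} (hV : ∀ p ∈ V₀, (p : ℝ) < alpha0 H)
    {p : ℕ} (hp : p.Prime) (hap : alpha0 H ≤ p) : ∃ i, p ∈ primeInterval V₀ H i := by
  have ha := alpha0_pos H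
  obtain ⟨i, h1, h2⟩ := exists_nat_pow_near ((one_le_div ha).2 hap) (one_lt_alphaH H)
  refine ⟨i, hp, fun hpV => (hV p hpV).not_ge hap, ?_, ?_⟩
  · rwa [le_div_iff₀' ha] at h1
  · rwa [div_lt_iff₀' ha] at h2

theorem lt_mul_of_mem_primeInterval {V₀ : Finset ℕ} {H : ℝ} {i j p q : ℕ} (hij : i ≤ j)
    (hp : p ∈ primeInterval V₀ H i) (hq : q ∈ primeInterval V₀ H j) :
    (p : ℝ) < alphaH H * q := by
  have hα := one_lt_alphaH H
  have ha := alpha0_pos H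
  calc (p : ℝ) < alpha0 H * alphaH H ^ (i + 1) := hp.2.2.2
    _ ≤ alpha0 H * alphaH H ^ (j + 1) := by
        gcongr
        exact hα.le
    _ = alphaH H * (alpha0 H * alphaH H ^ j) := by ring
    _ ≤ alphaH H * q := by
        gcongr
        exact hq.2.2.1

theorem inGoodGrid_of_conditions {V₀ : Finset ℕ} {H : ℝ} {n : ℕ} (hn : 0 < n)
    (hV : ∀ p ∈ V₀, (p : ℝ) < alpha0 H) (hy : 1 < Real.log (Real.log H))
    (hpair : ¬ ∃ p q : ℕ, alpha0 H ≤ p ∧ p ≤ q ∧ (q : ℝ) < alphaH H * p ∧ p * q ∣ n)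
    (hheight : n * alphaH H ^ (2 * Real.log (Real.log H)) ≤ H)
    (hsmall : (cardPrimeFactorsIn {p | (p : ℝ) < alpha0 H} n : ℝ) ≤
      Real.log (Real.log H) ^ ((1 : ℝ)/3 + 1/100))
    (hmedium : (cardPrimeFactorsIn {p | (p : ℝ) < alphaH H *
      Real.exp (Real.exp (Real.exp ((1/2) * Real.log (Real.log (Real.log H)))))} n : ℝ) ≤
      Real.log (Real.log H) ^ ((1 : ℝ)/2 + 1/100))
    (hlower : Real.log (Real.log H) - Real.log (Real.log H) ^ ((3 : ℝ)/4) ≤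
      cardPrimeFactorsIn {p | alpha0 H ≤ p} n)
    (hupper : (cardPrimeFactorsIn {p | alpha0 H ≤ p} n : ℝ) ≤
      Real.log (Real.log H) + Real.log (Real.log H) ^ ((3 : ℝ)/4)) :
    InGoodGrid V₀ H n := by
  classical
  have hα := one_lt_alphaH H
  have ha := alpha0_pos H
  rw [cardPrimeFactorsIn_eq_card_filter] at hlower hupper hsmall hmedium
  simp only [Set.mem_ofPred_eq] at hlower hupper hsmall hmedium
  set S : Finset ℕ := {p ∈ n.primeFactors | alpha0 H ≤ (p : ℝ)} with hS
  have hSmem : ∀ p, p ∈ S ↔ (p.Prime ∧ p ∣ n) ∧ alpha0 H ≤ p := fun p => by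
    simp [hS, hn.ne']
  obtain ⟨e, he⟩ : ∃ e : Fin S.card ↪o ℕ, e = S.orderEmbOfFin rfl := ⟨_, rfl⟩
  have heS : ∀ i, e i ∈ S := fun i => he ▸ S.orderEmbOfFin_mem rfl i
  have hprod : ∏ i, e i = ∏ p ∈ S, p := by
    rw [he, ← Finset.prod_image (g := S.orderEmbOfFin rfl) (f := fun p => p)
      (fun _ _ _ _ h => (S.orderEmbOfFin rfl).injective h), Finset.image_orderEmbOfFin_univ]
  obtain ⟨b, hb⟩ : ∏ p ∈ S, p ∣ n :=
    (Finset.prod_dvd_prod_of_subset _ _ _ (Finset.filter_subset _ _)).trans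
      (Nat.prod_primeFactors_dvd n)
  have hb0 : 0 < b := by
    rcases Nat.eq_zero_or_pos b with rfl | h
    · simp at hb; omega
    · exact h
  have hbn : b ∣ n := Dvd.intro_left _ hb.symm
  have hneq : n = b * ∏ i, e i := by rw [hprod, mul_comm, ← hb]
  have hbsmall : ∀ q ∈ b.primeFactors, (q : ℝ) < alpha0 H := by
    intro q hq
    by_contra! hqa
    have hqp := Nat.prime_of_mem_primeFactors hq
    have hqb := Nat.dvd_of_mem_primeFactors hq
    have hqS : q ∈ S := (hSmem q).2 ⟨⟨hqp, hqb.trans hbn⟩, hqa⟩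
    refine hpair ⟨q, q, hqa, le_rfl, ?_, ?_⟩
    · have : (0 : ℝ) < q := ha.trans_le hqa
      nlinarith
    · rw [hb]
      exact mul_dvd_mul (Finset.dvd_prod_of_mem _ hqS) hqb
  have hex : ∀ i, ∃ k, e i ∈ primeInterval V₀ H k := fun i =>
    exists_mem_primeInterval hV ((hSmem _).1 (heS i)).1.1 ((hSmem _).1 (heS i)).2
  choose k hk using hex
  have hkmono : StrictMono k := by
    intro i j hij
    by_contra! hji
    have hlt : e i < e j := e.lt_iff_lt.2 hij
    refine hpair ⟨e i, e j, ((hSmem _).1 (heS i)).2, hlt.le,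
      lt_mul_of_mem_primeInterval hji (hk j) (hk i), ?_⟩
    have hi := ((hSmem _).1 (heS i)).1
    have hj := ((hSmem _).1 (heS j)).1
    exact ((Nat.coprime_primes hi.1 hj.1).2 hlt.ne).mul_dvd_of_dvd_of_dvd hi.2 hj.2
  have hypow : Real.log (Real.log H) ^ ((3 : ℝ)/4) < Real.log (Real.log H) :=
    Real.rpow_lt_self_of_one_lt hy (by norm_num)
  refine ⟨b, S.card, k, e, hb0, ?_, hbsmall, hkmono, hk, hneq, ⟨hlower, hupper⟩, ?_, ?_, ?_⟩
  · have : (0 : ℝ) < S.card := by linarith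
    exact_mod_cast this
  · intro q hq
    have hle : ∏ i, (q i : ℝ) ≤ ∏ i, (alphaH H * e i) :=
      Finset.prod_le_prod (fun _ _ => by positivity) fun i _ =>
        (lt_mul_of_mem_primeInterval le_rfl (hq i) (hk i)).le
    rw [Finset.prod_mul_distrib, Finset.prod_const, Finset.card_univ, Fintype.card_fin] at hle
    have hpow : alphaH H ^ S.card ≤ alphaH H ^ (2 * Real.log (Real.log H)) := by
      rw [← Real.rpow_natCast]
      exact Real.rpow_le_rpow_of_exponent_le hα.le (by linarith)
    calc (b : ℝ) * ∏ i, (q i : ℝ) ≤ b * (alphaH H ^ S.card * ∏ i, (e i : ℝ)) := by gcongr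
      _ = n * alphaH H ^ S.card := by
          conv_rhs => rw [hneq]
          push_cast
          ring
      _ ≤ n * alphaH H ^ (2 * Real.log (Real.log H)) := by gcongr
      _ ≤ H := hheight
  · refine le_trans ?_ hsmall
    exact_mod_cast Finset.card_le_card fun q hq =>
      Finset.mem_filter.2 ⟨Nat.primeFactors_mono hbn hn.ne' hq, hbsmall q hq⟩
  · intro i hi q hq
    by_contra! hlt
    refine absurd hmedium (not_le.2 (hi.trans_le ?_))
    have hsub : (Finset.Iic i).image e ⊆ {p ∈ n.primeFactors | (p : ℝ) < alphaH H *
        Real.exp (Real.exp (Real.exp ((1/2) * Real.log (Real.log (Real.log H)))))} := by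
      intro p hp
      obtain ⟨j, hj, rfl⟩ := Finset.mem_image.1 hp
      refine Finset.mem_filter.2 ⟨(Finset.mem_filter.1 (heS j)).1, ?_⟩
      refine (lt_mul_of_mem_primeInterval (hkmono.monotone (Finset.mem_Iic.1 hj)) (hk j) hq).trans ?_
      gcongr
    have := Finset.card_le_card hsub
    rw [Finset.card_image_of_injective _ e.injective, Fin.card_Iic] at this
    exact_mod_cast this

open Filter in
theorem eventually_const_mul_rpow_le (c : ℝ) {a b : ℝ} (hab : a < b) :
    ∀ᶠ y : ℝ in atTop, c * y ^ a ≤ y ^ b := by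
  filter_upwards [(tendsto_rpow_atTop (sub_pos.2 hab)).eventually_ge_atTop c,
    eventually_gt_atTop 0] with y hc hy
  calc c * y ^ a ≤ y ^ (b - a) * y ^ a := by gcongr
    _ = y ^ b := by rw [← Real.rpow_add hy]; congr 1; ring

open Filter in
theorem eventually_add_two_mul_le_exp_rpow :
    ∀ᶠ y : ℝ in atTop, 2 + 2 * y ≤ Real.exp (y ^ (1 / 4 : ℝ)) := by
  have h := (tendsto_rpow_atTop (show (0 : ℝ) < 1 / 4 by norm_num)).eventually
    ((Real.tendsto_exp_div_pow_atTop 4).eventually_ge_atTop 4)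
  filter_upwards [h, eventually_ge_atTop 1] with y hy hy1
  have hpow : (y ^ (1 / 4 : ℝ)) ^ 4 = y := by
    rw [← Real.rpow_natCast, ← Real.rpow_mul (by linarith)]
    norm_num
  rw [hpow, le_div_iff₀ (by linarith)] at hy
  linarith

open Filter in
theorem tendsto_log_log_atTop : Tendsto (fun H : ℝ => Real.log (Real.log H)) atTop atTop :=
  Real.tendsto_log_atTop.comp Real.tendsto_log_atTop

theorem exp_mul_log_eq_rpow {y : ℝ} (hy : 0 < y) (a : ℝ) : Real.exp (a * Real.log y) = y ^ a := by
  rw [Real.rpow_def_of_pos hy, mul_comm]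

theorem alpha0_eq {H : ℝ} (hy : 0 < Real.log (Real.log H)) :
    alpha0 H = Real.exp (Real.exp (Real.log (Real.log H) ^ (1 / 3 : ℝ))) := by
  rw [alpha0, exp_mul_log_eq_rpow hy]

theorem alphaH_eq {H : ℝ} (hy : 0 < Real.log (Real.log H)) :
    alphaH H = Real.exp (Real.exp (-Real.exp (Real.log (Real.log H) ^ (1 / 4 : ℝ)))) := by
  rw [alphaH, exp_mul_log_eq_rpow hy, Real.exp_neg, one_div]

theorem exp_exp_log_log {H : ℝ} (hH : 1 < H) : Real.exp (Real.exp (Real.log (Real.log H))) = H := by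
  rw [Real.exp_log (Real.log_pos hH), Real.exp_log (by linarith)]

theorem sumPrimeInv_nonneg (E : Set ℕ) (N : ℕ) : 0 ≤ sumPrimeInv E N :=
  Finset.sum_nonneg fun _ _ => by positivity

theorem sumPrimeInv_le_sum_primesLE (E : Set ℕ) (N : ℕ) :
    sumPrimeInv E N ≤ ∑ p ∈ Nat.primesLE N, 1 / (p : ℝ) := by
  classical
  exact Finset.sum_le_sum_of_subset_of_nonneg (Finset.filter_subset _ _) fun _ _ _ => by positivity

theorem sumPrimeInv_lt_le_sum_primesLE_floor (x : ℝ) (N : ℕ) :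
    sumPrimeInv {p | (p : ℝ) < x} N ≤ ∑ p ∈ Nat.primesLE ⌊x⌋₊, 1 / (p : ℝ) := by
  refine Finset.sum_le_sum_of_subset_of_nonneg (fun p hp => ?_) fun _ _ _ => by positivity
  obtain ⟨hpN, hpx⟩ := Finset.mem_filter.1 hp
  exact Nat.mem_primesLE.2 ⟨Nat.le_floor (le_of_lt hpx), (Nat.mem_primesLE.1 hpN).2⟩

theorem sumPrimeInv_lt_add_sumPrimeInv_le (x : ℝ) (N : ℕ) :
    sumPrimeInv {p | (p : ℝ) < x} N + sumPrimeInv {p | x ≤ (p : ℝ)} N =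
      ∑ p ∈ Nat.primesLE N, 1 / (p : ℝ) := by
  classical
  rw [sumPrimeInv, sumPrimeInv,
    ← Finset.sum_filter_add_sum_filter_not (Nat.primesLE N) (fun p : ℕ => (p : ℝ) < x)]
  congr 1
  refine Finset.sum_congr (Finset.ext fun p => ?_) fun _ _ => rfl
  simp

theorem exists_sum_primesLE_floor_inv_le :
    ∃ M : ℝ, 0 ≤ M ∧ ∀ x : ℝ, 2 ≤ x →
      ∑ p ∈ Nat.primesLE ⌊x⌋₊, 1 / (p : ℝ) ≤ Real.log (Real.log x) + M := by
  obtain ⟨M, hM0, hM⟩ := exists_sum_primesLE_inv_le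
  refine ⟨M, hM0, fun x hx => ?_⟩
  have h2 : 2 ≤ ⌊x⌋₊ := Nat.le_floor (by exact_mod_cast hx)
  have h2' : (1 : ℝ) < ⌊x⌋₊ := by exact_mod_cast h2
  have hfl : (⌊x⌋₊ : ℝ) ≤ x := Nat.floor_le (by linarith)
  have := Real.log_le_log (Real.log_pos h2') (Real.log_le_log (by linarith) hfl)
  linarith [hM _ h2]

theorem two_lt_exp_exp {y : ℝ} (hy : 0 ≤ y) : 2 < Real.exp (Real.exp y) :=
  calc (2 : ℝ) < Real.exp 1 := by linarith [Real.exp_one_gt_d9]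
    _ ≤ Real.exp (Real.exp y) := Real.exp_le_exp.2 (Real.one_le_exp hy)

open Filter in
theorem eventually_card_pair_le :
    ∀ᶠ H : ℝ in atTop, ((open Classical in {n ∈ Finset.Ioc 0 ⌊H⌋₊ | ∃ p q : ℕ, alpha0 H ≤ p ∧ p ≤ q ∧
        (q : ℝ) < alphaH H * p ∧ p * q ∣ n}).card : ℝ) ≤
      H * Real.exp (-(1 / 3) * Real.log (Real.log H) ^ (1 / 3 : ℝ)) := by
  filter_upwards [tendsto_log_log_atTop.eventually eventually_add_two_mul_le_exp_rpow,
    tendsto_log_log_atTop.eventually_ge_atTop 1, eventually_ge_atTop 2] with H hexp hy hH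
  have hy0 : 0 < Real.log (Real.log H) := by linarith
  have hN : 1 ≤ ⌊H⌋₊ := Nat.le_floor (by push_cast; linarith)
  refine (card_exists_mul_dvd_le (alpha0_pos H) (one_lt_alphaH H).le hN).trans ?_
  rw [alpha0_eq hy0, alphaH_eq hy0]
  have hNH : (⌊H⌋₊ : ℝ) ≤ H := Nat.floor_le (by linarith)
  have hlogN : Real.log ⌊H⌋₊ ≤ Real.exp (Real.log (Real.log H)) := by
    rw [Real.exp_log (Real.log_pos (by linarith))]
    exact Real.log_le_log (by exact_mod_cast hN) hNH
  have hlogN0 : 0 ≤ Real.log ⌊H⌋₊ := Real.log_nonneg (by exact_mod_cast hN)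
  set y := Real.log (Real.log H)
  set ε := Real.exp (-Real.exp (y ^ (1 / 4 : ℝ))) with hε
  have hε1 : ε ≤ 1 := Real.exp_le_one_iff.2 (neg_nonpos.2 (Real.exp_pos _).le)
  have hε0 : 0 < ε := Real.exp_pos _
  have h1 : Real.exp ε - 1 ≤ 2 * ε := by
    have := Real.abs_exp_sub_one_le (x := ε) (by rwa [abs_of_pos hε0])
    rw [abs_of_pos hε0] at this
    exact (le_abs_self _).trans this
  have h2 : 1 / Real.exp (Real.exp (y ^ (1 / 3 : ℝ))) ≤ ε := by
    rw [hε, Real.exp_neg, one_div]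
    gcongr
    · norm_num
  have h3 : 1 + Real.log ⌊H⌋₊ ≤ 2 * Real.exp y := by
    linarith [Real.one_le_exp hy0.le]
  have h4 : y ^ (1 / 3 : ℝ) ≤ y := by
    conv_rhs => rw [← Real.rpow_one y]
    exact Real.rpow_le_rpow_of_exponent_le hy (by norm_num)
  have h5 : (6 : ℝ) ≤ Real.exp 2 := by
    have h := Real.exp_one_gt_d9
    rw [show (2 : ℝ) = 1 + 1 by norm_num, Real.exp_add]
    nlinarith
  have h0 : 0 ≤ Real.exp ε - 1 + 1 / Real.exp (Real.exp (y ^ (1 / 3 : ℝ))) := by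
    have := Real.add_one_le_exp ε
    have := one_div_pos.2 (Real.exp_pos (Real.exp (y ^ (1 / 3 : ℝ))))
    linarith
  calc (⌊H⌋₊ : ℝ) * ((Real.exp ε - 1 + 1 / Real.exp (Real.exp (y ^ (1 / 3 : ℝ)))) *
        (1 + Real.log ⌊H⌋₊)) ≤ H * ((2 * ε + ε) * (2 * Real.exp y)) := by
        gcongr
    _ = H * (6 * Real.exp (y + -Real.exp (y ^ (1 / 4 : ℝ)))) := by
        rw [Real.exp_add, ← hε]; ring
    _ ≤ H * (Real.exp 2 * Real.exp (y + -Real.exp (y ^ (1 / 4 : ℝ)))) := by gcongr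
    _ ≤ _ := by
        rw [← Real.exp_add]
        gcongr
        linarith

open Filter in
theorem eventually_card_height_le :
    ∀ᶠ H : ℝ in atTop, ((open Classical in {n ∈ Finset.Ioc 0 ⌊H⌋₊ |
        H < ((n : ℕ) : ℝ) * alphaH H ^ (2 * Real.log (Real.log H))}).card : ℝ) ≤
      2 * H * Real.exp (-(1 / 3) * Real.log (Real.log H) ^ (1 / 3 : ℝ)) := by
  filter_upwards [tendsto_log_log_atTop.eventually eventually_add_two_mul_le_exp_rpow,
    tendsto_log_log_atTop.eventually_ge_atTop 1, eventually_ge_atTop 2] with H hexp hy hH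
  have hy0 : 0 < Real.log (Real.log H) := by linarith
  have hHeq := exp_exp_log_log (show 1 < H by linarith)
  rw [alphaH_eq hy0]
  set y := Real.log (Real.log H)
  set ε := Real.exp (-Real.exp (y ^ (1 / 4 : ℝ))) with hε
  have hε0 : 0 < ε := Real.exp_pos _
  have hX0 : 0 ≤ H * Real.exp (-(2 * y * ε)) := by positivity
  have hsub : {n ∈ Finset.Ioc 0 ⌊H⌋₊ | H < ((n : ℕ) : ℝ) * Real.exp ε ^ (2 * y)} ⊆
      Finset.Ioc ⌊H * Real.exp (-(2 * y * ε))⌋₊ ⌊H⌋₊ := by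
    intro n hn
    obtain ⟨h1, h2⟩ := Finset.mem_filter.1 hn
    refine Finset.mem_Ioc.2 ⟨?_, (Finset.mem_Ioc.1 h1).2⟩
    rw [Nat.floor_lt hX0, Real.exp_neg, ← div_eq_mul_inv, div_lt_iff₀ (Real.exp_pos _)]
    rwa [← Real.exp_mul, mul_comm ε] at h2
  have hle : H * Real.exp (-(2 * y * ε)) ≤ H := by
    refine mul_le_of_le_one_right (by linarith) (Real.exp_le_one_iff.2 ?_)
    have : 0 ≤ 2 * y * ε := by positivity
    linarith
  have hcard : ((Finset.Ioc ⌊H * Real.exp (-(2 * y * ε))⌋₊ ⌊H⌋₊).card : ℝ) ≤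
      H - H * Real.exp (-(2 * y * ε)) + 1 := by
    rw [Nat.card_Ioc, Nat.cast_sub (Nat.floor_le_floor hle)]
    have h1 := Nat.floor_le (show 0 ≤ H by linarith)
    have h2 := Nat.lt_floor_add_one (H * Real.exp (-(2 * y * ε)))
    linarith
  have h4 : y ^ (1 / 3 : ℝ) ≤ y := by
    conv_rhs => rw [← Real.rpow_one y]
    exact Real.rpow_le_rpow_of_exponent_le hy (by norm_num)
  have h5 : 1 ≤ H * Real.exp (-(1 / 3) * y ^ (1 / 3 : ℝ)) := by
    rw [← hHeq, ← Real.exp_add]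
    refine Real.one_le_exp ?_
    linarith [Real.add_one_le_exp y]
  have h6 : 2 * y * ε ≤ Real.exp (-(1 / 3) * y ^ (1 / 3 : ℝ)) := by
    have h2y : 2 * y ≤ Real.exp (2 + y) := by
      have h1 := Real.add_one_le_exp 2
      have h2 := Real.add_one_le_exp y
      rw [Real.exp_add]
      nlinarith
    calc 2 * y * ε ≤ Real.exp (2 + y) * ε := by gcongr
      _ ≤ _ := by
        rw [hε, ← Real.exp_add]
        gcongr
        linarith
  have h7 := Real.add_one_le_exp (-(2 * y * ε))
  have h8 : H * (1 - 2 * y * ε) ≤ H * Real.exp (-(2 * y * ε)) := by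
    gcongr
    linarith
  have h9 : H * (2 * y * ε) ≤ H * Real.exp (-(1 / 3) * y ^ (1 / 3 : ℝ)) := by gcongr
  have hsub' := Finset.card_le_card hsub
  calc _ ≤ ((Finset.Ioc ⌊H * Real.exp (-(2 * y * ε))⌋₊ ⌊H⌋₊).card : ℝ) := by
        exact_mod_cast (le_of_eq (by congr)).trans hsub'
    _ ≤ _ := by linarith

open Filter in
theorem exists_eventually_card_cardPrimeFactorsIn_lt_le {x : ℝ → ℝ} {a b c : ℝ}
    (ha : 1 / 3 ≤ a) (hab : a < b)
    (hxE : ∀ᶠ H in atTop, 2 ≤ x H ∧ Real.log (Real.log (x H)) ≤ Real.log (Real.log H) ^ a + c) :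
    ∃ C : ℝ, ∀ᶠ H : ℝ in atTop, ((open Classical in {n ∈ Finset.Ioc 0 ⌊H⌋₊ |
        Real.log (Real.log H) ^ b < cardPrimeFactorsIn {p | (p : ℝ) < x H} n}).card : ℝ) ≤
      C * H * Real.exp (-(1 / 3) * Real.log (Real.log H) ^ (1 / 3 : ℝ)) := by
  classical
  obtain ⟨K, hK0, hK⟩ := exists_card_le_mul_cardPrimeFactorsIn
  obtain ⟨M, hM0, hM⟩ := exists_sum_primesLE_floor_inv_le
  refine ⟨K * Real.exp (2 * (c + M)), ?_⟩
  filter_upwards [tendsto_log_log_atTop.eventually (eventually_const_mul_rpow_le 3 hab),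
    tendsto_log_log_atTop.eventually_ge_atTop 1, eventually_ge_atTop 2, hxE] with H hpow hy hH hx
  have hN : 2 ≤ ⌊H⌋₊ := Nat.le_floor (by exact_mod_cast hH)
  have hNH : (⌊H⌋₊ : ℝ) ≤ H := Nat.floor_le (by linarith)
  have hS := (sumPrimeInv_lt_le_sum_primesLE_floor (x H) ⌊H⌋₊).trans (hM _ hx.1)
  have hS0 := sumPrimeInv_nonneg {p | (p : ℝ) < x H} ⌊H⌋₊
  set y := Real.log (Real.log H)
  have h1 : y ^ (1 / 3 : ℝ) ≤ y ^ a := Real.rpow_le_rpow_of_exponent_le hy ha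
  have he : Real.exp 1 - 1 ≤ 2 := by linarith [Real.exp_one_lt_three]
  calc _ ≤ ({n ∈ Finset.Ioc 0 ⌊H⌋₊ |
        y ^ b ≤ 1 * cardPrimeFactorsIn {p | (p : ℝ) < x H} n}.card : ℝ) := by
        refine Nat.cast_le.2 (Finset.card_le_card fun n hn => ?_)
        simp only [Finset.mem_filter] at hn ⊢
        exact ⟨hn.1, by linarith [hn.2]⟩
    _ ≤ K * ⌊H⌋₊ * Real.exp ((Real.exp 1 - 1) * sumPrimeInv {p | (p : ℝ) < x H} ⌊H⌋₊ - y ^ b) :=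
        hK _ _ _ le_rfl _ hN
    _ ≤ K * H * Real.exp (2 * (c + M) + -(1 / 3) * y ^ (1 / 3 : ℝ)) := by
        have h2 := mul_le_mul_of_nonneg_right he hS0
        have h3 : 0 ≤ y ^ (1 / 3 : ℝ) := Real.rpow_nonneg (by linarith) _
        gcongr
        linarith [hx.2]
    _ = _ := by rw [Real.exp_add]; ring

theorem rpow_quarter_identities {y : ℝ} (hy : 0 < y) :
    (y ^ (1 / 4 : ℝ)) ^ 2 = y ^ (1 / 2 : ℝ) ∧ (y ^ (1 / 4 : ℝ)) ^ 3 = y ^ (3 / 4 : ℝ) ∧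
      (y ^ (1 / 4 : ℝ)) ^ 4 = y := by
  refine ⟨?_, ?_, ?_⟩ <;> rw [← Real.rpow_natCast, ← Real.rpow_mul hy.le] <;> norm_num

open Filter in
theorem exists_eventually_card_upper_tail_le (E : ℝ → Set ℕ) :
    ∃ C : ℝ, ∀ᶠ H : ℝ in atTop, ((open Classical in {n ∈ Finset.Ioc 0 ⌊H⌋₊ |
        Real.log (Real.log H) + Real.log (Real.log H) ^ (3 / 4 : ℝ) <
          cardPrimeFactorsIn (E H) n}).card : ℝ) ≤
      C * H * Real.exp (-(1 / 3) * Real.log (Real.log H) ^ (1 / 3 : ℝ)) := by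
  classical
  obtain ⟨K, hK0, hK⟩ := exists_card_le_mul_cardPrimeFactorsIn
  obtain ⟨M, hM0, hM⟩ := exists_sum_primesLE_floor_inv_le
  refine ⟨K * Real.exp (2 * M), ?_⟩
  filter_upwards [tendsto_log_log_atTop.eventually (eventually_const_mul_rpow_le (4 / 3)
    (show (1 / 3 : ℝ) < 1 / 2 by norm_num)),
    tendsto_log_log_atTop.eventually_ge_atTop 1, eventually_ge_atTop 2] with H hpow hy hH
  have hN : 2 ≤ ⌊H⌋₊ := Nat.le_floor (by exact_mod_cast hH)
  have hNH : (⌊H⌋₊ : ℝ) ≤ H := Nat.floor_le (by linarith)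
  have hS := (sumPrimeInv_le_sum_primesLE (E H) ⌊H⌋₊).trans (hM _ hH)
  have hS0 := sumPrimeInv_nonneg (E H) ⌊H⌋₊
  set y := Real.log (Real.log H)
  obtain ⟨hw2, hw3, hw4⟩ := rpow_quarter_identities (show 0 < y by linarith)
  have hw1 : 1 ≤ y ^ (1 / 4 : ℝ) := Real.one_le_rpow hy (by norm_num)
  set w := y ^ (1 / 4 : ℝ)
  rw [← hw2] at hpow
  rw [← hw3]
  obtain ⟨t, ht⟩ : ∃ t : ℝ, t = 1 / (2 * w) := ⟨_, rfl⟩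
  have htw : t * w = 1 / 2 := by rw [ht]; field_simp
  have ht0 : 0 < t := by rw [ht]; positivity
  have ht1 : t ≤ 1 / 2 := by nlinarith
  have het : Real.exp t - 1 ≤ t + t ^ 2 := by
    have := (abs_le.1 (Real.abs_exp_sub_one_sub_id_le (x := t) (by rw [abs_of_pos ht0]; linarith))).2
    linarith
  have hexp : (Real.exp t - 1) * sumPrimeInv (E H) ⌊H⌋₊ - t * (y + w ^ 3) ≤
      2 * M + -(1 / 3) * y ^ (1 / 3 : ℝ) := by
    have h1 : (Real.exp t - 1) * sumPrimeInv (E H) ⌊H⌋₊ ≤ (t + t ^ 2) * (y + M) :=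
      mul_le_mul het hS hS0 (by positivity)
    have h2 : t ^ 2 * y = w ^ 2 / 4 := by
      rw [← hw4, show t ^ 2 * w ^ 4 = (t * w) ^ 2 * w ^ 2 by ring, htw]; ring
    have h3 : t * w ^ 3 = w ^ 2 / 2 := by
      rw [show t * w ^ 3 = (t * w) * w ^ 2 by ring, htw]; ring
    have h4 : (t + t ^ 2) * M ≤ 2 * M := by
      gcongr
      nlinarith
    linarith
  calc _ ≤ ({n ∈ Finset.Ioc 0 ⌊H⌋₊ |
        t * (y + w ^ 3) ≤ t * cardPrimeFactorsIn (E H) n}.card : ℝ) := by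
        refine Nat.cast_le.2 (Finset.card_le_card fun n hn => ?_)
        simp only [Finset.mem_filter] at hn ⊢
        exact ⟨hn.1, mul_le_mul_of_nonneg_left hn.2.le ht0.le⟩
    _ ≤ K * ⌊H⌋₊ * Real.exp ((Real.exp t - 1) * sumPrimeInv (E H) ⌊H⌋₊ - t * (y + w ^ 3)) :=
        hK _ _ _ (by linarith) _ hN
    _ ≤ K * H * Real.exp (2 * M + -(1 / 3) * y ^ (1 / 3 : ℝ)) := by gcongr
    _ = _ := by rw [Real.exp_add]; ring

open Filter in
theorem exists_eventually_card_lower_tail_le :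
    ∃ C : ℝ, ∀ᶠ H : ℝ in atTop, ((open Classical in {n ∈ Finset.Ioc 0 ⌊H⌋₊ |
        cardPrimeFactorsIn {p | alpha0 H ≤ (p : ℝ)} n <
          Real.log (Real.log H) - Real.log (Real.log H) ^ (3 / 4 : ℝ)}).card : ℝ) ≤
      C * H * Real.exp (-(1 / 3) * Real.log (Real.log H) ^ (1 / 3 : ℝ)) := by
  classical
  obtain ⟨K, hK0, hK⟩ := exists_card_le_mul_cardPrimeFactorsIn
  obtain ⟨M, hM0, hM⟩ := exists_sum_primesLE_floor_inv_le
  refine ⟨K * Real.exp (M + 3), ?_⟩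
  filter_upwards [tendsto_log_log_atTop.eventually (eventually_const_mul_rpow_le (16 / 3)
    (show (1 / 3 : ℝ) < 1 / 2 by norm_num)),
    tendsto_log_log_atTop.eventually_ge_atTop 1, eventually_ge_atTop 2] with H hpow hy hH
  have hN : 2 ≤ ⌊H⌋₊ := Nat.le_floor (by exact_mod_cast hH)
  have hNH : (⌊H⌋₊ : ℝ) ≤ H := Nat.floor_le (by linarith)
  have hS : Real.log (Real.log H) - Real.log (Real.log H) ^ (1 / 3 : ℝ) - (M + 3) ≤
      sumPrimeInv {p | alpha0 H ≤ (p : ℝ)} ⌊H⌋₊ := by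
    have h1 := sumPrimeInv_lt_add_sumPrimeInv_le (alpha0 H) ⌊H⌋₊
    have h2 := log_log_le_sum_primesLE_inv (show 1 < H by linarith)
    have ha := alpha0_eq (show 0 < Real.log (Real.log H) by linarith)
    have h3 := (sumPrimeInv_lt_le_sum_primesLE_floor (alpha0 H) ⌊H⌋₊).trans
      (hM _ (ha ▸ (two_lt_exp_exp (Real.rpow_nonneg (by linarith) _)).le))
    have h4 : Real.log (Real.log (alpha0 H)) = Real.log (Real.log H) ^ (1 / 3 : ℝ) := by
      rw [ha, Real.log_exp, Real.log_exp]
    linarith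
  have hS0 := sumPrimeInv_nonneg {p | alpha0 H ≤ (p : ℝ)} ⌊H⌋₊
  set y := Real.log (Real.log H)
  set S := sumPrimeInv {p | alpha0 H ≤ (p : ℝ)} ⌊H⌋₊
  obtain ⟨hw2, hw3, hw4⟩ := rpow_quarter_identities (show 0 < y by linarith)
  have hw1 : 1 ≤ y ^ (1 / 4 : ℝ) := Real.one_le_rpow hy (by norm_num)
  have hc0 : 0 ≤ y ^ (1 / 3 : ℝ) := Real.rpow_nonneg (by linarith) _
  set w := y ^ (1 / 4 : ℝ)
  rw [← hw2] at hpow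
  rw [← hw3]
  obtain ⟨t, ht⟩ : ∃ t : ℝ, t = 1 / (2 * w) := ⟨_, rfl⟩
  have htw : t * w = 1 / 2 := by rw [ht]; field_simp
  have ht0 : 0 < t := by rw [ht]; positivity
  have ht1 : t ≤ 1 / 2 := by nlinarith
  have het : Real.exp (-t) - 1 ≤ -t + t ^ 2 := by
    have := (abs_le.1 (Real.abs_exp_sub_one_sub_id_le (x := -t)
      (by rw [abs_neg, abs_of_pos ht0]; linarith))).2
    nlinarith
  have hexp : (Real.exp (-t) - 1) * S - -t * (y - w ^ 3) ≤
      (M + 3) + -(1 / 3) * y ^ (1 / 3 : ℝ) := by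
    have h1 : (Real.exp (-t) - 1) * S ≤ (-t + t ^ 2) * S := by gcongr
    have h2 : t ^ 2 * y = w ^ 2 / 4 := by
      rw [← hw4, show t ^ 2 * w ^ 4 = (t * w) ^ 2 * w ^ 2 by ring, htw]; ring
    have h3 : t * w ^ 3 = w ^ 2 / 2 := by
      rw [show t * w ^ 3 = (t * w) * w ^ 2 by ring, htw]; ring
    have h4 : (t - t ^ 2) * (y - y ^ (1 / 3 : ℝ) - (M + 3)) ≤ (t - t ^ 2) * S := by
      gcongr
      nlinarith
    have h5 : (t - t ^ 2) * (y ^ (1 / 3 : ℝ) + (M + 3)) ≤ 1 * (y ^ (1 / 3 : ℝ) + (M + 3)) := by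
      gcongr
      nlinarith
    linarith
  calc _ ≤ ({n ∈ Finset.Ioc 0 ⌊H⌋₊ | -t * (y - w ^ 3) ≤
        -t * cardPrimeFactorsIn {p | alpha0 H ≤ (p : ℝ)} n}.card : ℝ) := by
        refine Nat.cast_le.2 (Finset.card_le_card fun n hn => ?_)
        simp only [Finset.mem_filter] at hn ⊢
        exact ⟨hn.1, mul_le_mul_of_nonpos_left hn.2.le (by linarith)⟩
    _ ≤ K * ⌊H⌋₊ * Real.exp ((Real.exp (-t) - 1) * S - -t * (y - w ^ 3)) :=
        hK _ _ _ (by linarith) _ hN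
    _ ≤ K * H * Real.exp ((M + 3) + -(1 / 3) * y ^ (1 / 3 : ℝ)) := by gcongr
    _ = _ := by rw [Real.exp_add]; ring

open Filter in
theorem tendsto_alpha0_atTop : Tendsto alpha0 atTop atTop := by
  unfold alpha0
  exact Real.tendsto_exp_atTop.comp (Real.tendsto_exp_atTop.comp (Real.tendsto_exp_atTop.comp
    ((Real.tendsto_log_atTop.comp tendsto_log_log_atTop).const_mul_atTop (by norm_num))))

theorem log_log_pos {H : ℝ} (hH : 20 ≤ H) : 0 < Real.log (Real.log H) := by
  refine Real.log_pos ?_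
  rw [Real.lt_log_iff_exp_lt (by linarith)]
  linarith [Real.exp_one_lt_three]

theorem saving_eq {H : ℝ} (hy : 0 < Real.log (Real.log H)) :
    (Real.exp (Real.exp ((1/3) * Real.log (Real.log (Real.log H))))) ^ (-(1/3 : ℝ)) =
      Real.exp (-(1 / 3) * Real.log (Real.log H) ^ (1 / 3 : ℝ)) := by
  rw [exp_mul_log_eq_rpow hy, ← Real.exp_mul, mul_comm]

open Filter in
theorem exists_eventually_card_not_inGoodGrid_le (V₀ : Finset ℕ) :
    ∃ C : ℝ, ∀ᶠ H : ℝ in atTop,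
      ((open Classical in {n ∈ Finset.Ioc 0 ⌊H⌋₊ | ¬ InGoodGrid V₀ H n}).card : ℝ) ≤
        C * H * Real.exp (-(1 / 3) * Real.log (Real.log H) ^ (1 / 3 : ℝ)) := by
  classical
  have hx3 : ∀ᶠ H in atTop, 2 ≤ alpha0 H ∧
      Real.log (Real.log (alpha0 H)) ≤ Real.log (Real.log H) ^ (1 / 3 : ℝ) + 0 := by
    filter_upwards [tendsto_log_log_atTop.eventually_gt_atTop 0] with H hy
    rw [alpha0_eq hy, Real.log_exp, Real.log_exp]
    exact ⟨(two_lt_exp_exp (Real.rpow_nonneg hy.le _)).le, by linarith⟩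
  have hx4 : ∀ᶠ H in atTop, 2 ≤ alphaH H *
        Real.exp (Real.exp (Real.exp ((1/2) * Real.log (Real.log (Real.log H))))) ∧
      Real.log (Real.log (alphaH H *
        Real.exp (Real.exp (Real.exp ((1/2) * Real.log (Real.log (Real.log H))))))) ≤
        Real.log (Real.log H) ^ (1 / 2 : ℝ) + 1 := by
    filter_upwards [tendsto_log_log_atTop.eventually_gt_atTop 0] with H hy
    have h0 := Real.rpow_nonneg hy.le (1 / 2)
    rw [exp_mul_log_eq_rpow hy]
    constructor
    · have := two_lt_exp_exp h0
      nlinarith [one_lt_alphaH H]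
    · rw [alphaH_eq hy, ← Real.exp_add, Real.log_exp]
      set z := Real.log (Real.log H) ^ (1 / 2 : ℝ)
      have h1 : Real.exp (-Real.exp (Real.log (Real.log H) ^ (1 / 4 : ℝ))) ≤ 1 :=
        Real.exp_le_one_iff.2 (neg_nonpos.2 (Real.exp_pos _).le)
      rw [Real.log_le_iff_le_exp (by positivity), Real.exp_add]
      have h2 := Real.one_le_exp h0
      have h3 := Real.exp_one_gt_d9
      nlinarith
  obtain ⟨C₃, h3⟩ := exists_eventually_card_cardPrimeFactorsIn_lt_le (b := 1 / 3 + 1 / 100)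
    le_rfl (by norm_num) hx3
  obtain ⟨C₄, h4⟩ := exists_eventually_card_cardPrimeFactorsIn_lt_le (b := 1 / 2 + 1 / 100)
    (by norm_num) (by norm_num) hx4
  obtain ⟨C₅, h5⟩ := exists_eventually_card_upper_tail_le fun H => {p | alpha0 H ≤ (p : ℝ)}
  obtain ⟨C₆, h6⟩ := exists_eventually_card_lower_tail_le
  have hV : ∀ᶠ H in atTop, ∀ p ∈ V₀, (p : ℝ) < alpha0 H :=
    (eventually_all_finset V₀).2 fun p _ => tendsto_alpha0_atTop.eventually_gt_atTop _
  refine ⟨1 + 2 + C₃ + C₄ + C₅ + C₆, ?_⟩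
  filter_upwards [hV, tendsto_log_log_atTop.eventually_gt_atTop 1, eventually_card_pair_le,
    eventually_card_height_le, h3, h4, h5, h6] with H hV hy h1 h2 h3 h4 h5 h6
  set T := Real.exp (-(1 / 3) * Real.log (Real.log H) ^ (1 / 3 : ℝ))
  refine le_trans ?_ ((add_le_add (add_le_add (add_le_add (add_le_add (add_le_add h1 h2) h3) h4)
    h5) h6).trans_eq (by ring))
  have hunion : {n ∈ Finset.Ioc 0 ⌊H⌋₊ | ¬ InGoodGrid V₀ H n} ⊆
      {n ∈ Finset.Ioc 0 ⌊H⌋₊ | ∃ p q : ℕ, alpha0 H ≤ p ∧ p ≤ q ∧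
        (q : ℝ) < alphaH H * p ∧ p * q ∣ n} ∪
      {n ∈ Finset.Ioc 0 ⌊H⌋₊ | H < ((n : ℕ) : ℝ) * alphaH H ^ (2 * Real.log (Real.log H))} ∪
      {n ∈ Finset.Ioc 0 ⌊H⌋₊ | Real.log (Real.log H) ^ (1 / 3 + 1 / 100 : ℝ) <
        cardPrimeFactorsIn {p | (p : ℝ) < alpha0 H} n} ∪
      {n ∈ Finset.Ioc 0 ⌊H⌋₊ | Real.log (Real.log H) ^ (1 / 2 + 1 / 100 : ℝ) <
        cardPrimeFactorsIn {p | (p : ℝ) < alphaH H * Real.exp (Real.exp (Real.exp ((1/2) *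
          Real.log (Real.log (Real.log H)))))} n} ∪
      {n ∈ Finset.Ioc 0 ⌊H⌋₊ | Real.log (Real.log H) + Real.log (Real.log H) ^ (3 / 4 : ℝ) <
        cardPrimeFactorsIn {p | alpha0 H ≤ (p : ℝ)} n} ∪
      {n ∈ Finset.Ioc 0 ⌊H⌋₊ | cardPrimeFactorsIn {p | alpha0 H ≤ (p : ℝ)} n <
        Real.log (Real.log H) - Real.log (Real.log H) ^ (3 / 4 : ℝ)} := by
    intro n hn
    obtain ⟨hnI, hbad⟩ := Finset.mem_filter.1 hn
    by_contra hgood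
    simp only [Finset.mem_union, Finset.mem_filter, hnI, true_and, not_or, not_lt] at hgood
    obtain ⟨⟨⟨⟨⟨g1, g2⟩, g3⟩, g4⟩, g5⟩, g6⟩ := hgood
    exact hbad (inGoodGrid_of_conditions (Finset.mem_Ioc.1 hnI).1 hV hy g1 g2 g3 g4 g6 g5)
  have hcard := (Finset.card_le_card hunion).trans <| (Finset.card_union_le _ _).trans <|
    Nat.add_le_add_right ((Finset.card_union_le _ _).trans <|
    Nat.add_le_add_right ((Finset.card_union_le _ _).trans <|
    Nat.add_le_add_right ((Finset.card_union_le _ _).trans <|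
    Nat.add_le_add_right (Finset.card_union_le _ _) _) _) _) _
  refine (Nat.cast_le (α := ℝ).2 hcard).trans (le_of_eq ?_)
  push_cast
  congr

/-- For a fixed finite set `𝒱₀` of primes, there is `C > 0` (depending only on `𝒱₀`)
such that for all `H ≥ 20`, the number of positive integers `n ≤ H` not lying in any
good unfiltered grid of height `≤ H` is at most
`C · H · (exp(exp((1/3)·log log log H)))^{-1/3}`. -/
theorem most_integers_in_good_grid (V₀ : Finset ℕ) (hV₀ : ∀ p ∈ V₀, p.Prime) :
    ∃ C : ℝ, 0 < C ∧ ∀ H : ℝ, 20 ≤ H →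
      (Nat.card {n : ℕ // 1 ≤ n ∧ (n : ℝ) ≤ H ∧ ¬ InGoodGrid V₀ H n} : ℝ)
        ≤ C * H *
          (Real.exp (Real.exp ((1/3) * Real.log (Real.log (Real.log H))))) ^ (-(1/3 : ℝ)) := by
  classical
  obtain ⟨C, hC⟩ := exists_eventually_card_not_inGoodGrid_le V₀
  obtain ⟨H₀, hH₀⟩ := Filter.eventually_atTop.1 hC
  set X := max H₀ 20
  obtain ⟨D, hD⟩ : ∃ D, D = Real.exp ((1 / 3) * Real.log (Real.log X) ^ (1 / 3 : ℝ)) := ⟨_, rfl⟩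
  refine ⟨max C D, lt_max_of_lt_right (hD ▸ Real.exp_pos _), fun H hH => ?_⟩
  have hy := log_log_pos hH
  have hcard : Nat.card {n : ℕ // 1 ≤ n ∧ (n : ℝ) ≤ H ∧ ¬ InGoodGrid V₀ H n} =
      {n ∈ Finset.Ioc 0 ⌊H⌋₊ | ¬ InGoodGrid V₀ H n}.card := by
    refine Nat.subtype_card _ fun n => ?_
    rw [Finset.mem_filter, Finset.mem_Ioc, Nat.le_floor_iff (by linarith), and_assoc]
    rfl
  rw [hcard, saving_eq hy]
  rcases le_total H₀ H with h | h
  · refine (le_of_eq (by congr)).trans ((hH₀ H h).trans ?_)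
    gcongr
    exact le_max_left _ _
  · have hHX : H ≤ X := h.trans (le_max_left _ _)
    have hlog : Real.log (Real.log H) ≤ Real.log (Real.log X) :=
      Real.log_le_log (Real.log_pos (by linarith)) (Real.log_le_log (by linarith) hHX)
    calc _ ≤ (⌊H⌋₊ : ℝ) := by
          have := Finset.card_filter_le (Finset.Ioc 0 ⌊H⌋₊) fun n => ¬ InGoodGrid V₀ H n
          rw [Nat.card_Ioc, Nat.sub_zero] at this
          exact_mod_cast this
      _ ≤ H := Nat.floor_le (by linarith)
      _ = H * 1 := (mul_one H).symm
      _ ≤ H * (D * Real.exp (-(1 / 3) * Real.log (Real.log H) ^ (1 / 3 : ℝ))) := by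
          gcongr
          rw [hD, ← Real.exp_add]
          refine Real.one_le_exp ?_
          have := Real.rpow_le_rpow hy.le hlog (show (0 : ℝ) ≤ 1 / 3 by norm_num)
          linarith
      _ = D * H * Real.exp (-(1 / 3) * Real.log (Real.log H) ^ (1 / 3 : ℝ)) := by ring
      _ ≤ _ := by
          gcongr
          exact le_max_right _ _
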